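/- Let E be a finite set with |E| = n, let w : E → ℝ be a nonnegative weight function, let A* ⊆ E with |A*| = k where 1 ≤ k ≤ n, and let ε be a real number with 0 < ε ≤ 1. Let m be a natural number with 1 ≤ m ≤ n and (m : ℝ) ≥ (n/k) · log(1/ε). Then, with R a uniformly random m-element subset of E, E[max_{e ∈ R} w(e)] ≥ ((1 − ε)/k) · Σ_{e ∈ A*} w(e); in counting form, (1/C(n, m)) · Σ_{S ⊆ E, |S| = m} max_{e ∈ S} w(e) ≥ ((1 − ε)/k) · Σ_{e ∈ A*} w(e). -/

import Mathlib

/-- Descending factorials of `a ≤ n`, relative to those of `n`, decay at least geometrically. -/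
theorem descFactorial_mul_pow_le {a n : ℕ} (h : a ≤ n) (m : ℕ) :
    a.descFactorial m * n ^ m ≤ a ^ m * n.descFactorial m := by
  induction m with
  | zero => simp
  | succ m ih =>
    have hstep : (a - m) * n ≤ a * (n - m) := by
      rw [Nat.sub_mul, Nat.mul_sub]
      have : a * m ≤ m * n := by rw [mul_comm a m]; exact Nat.mul_le_mul_left m h
      omega
    rw [Nat.descFactorial_succ, Nat.descFactorial_succ]
    calc (a - m) * a.descFactorial m * n ^ (m + 1)
        = ((a - m) * n) * (a.descFactorial m * n ^ m) := by ring
      _ ≤ (a * (n - m)) * (a ^ m * n.descFactorial m) := Nat.mul_le_mul hstep ih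
      _ = a ^ (m + 1) * ((n - m) * n.descFactorial m) := by ring

theorem choose_mul_pow_le {a n : ℕ} (h : a ≤ n) (m : ℕ) :
    a.choose m * n ^ m ≤ a ^ m * n.choose m := by
  have hdesc := descFactorial_mul_pow_le h m
  rw [Nat.descFactorial_eq_factorial_mul_choose, Nat.descFactorial_eq_factorial_mul_choose] at hdesc
  refine Nat.le_of_mul_le_mul_left ?_ m.factorial_pos
  linarith

/-- A sample of size at least `(n / k) * log (1 / ε)` misses a fixed `k`-element set with
probability at most `ε`. -/
theorem choose_sub_le_mul_choose {n k m : ℕ} {ε : ℝ} (hk1 : 1 ≤ k) (hkn : k ≤ n) (hε0 : 0 < ε)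
    (hm : (m : ℝ) ≥ ((n : ℝ) / (k : ℝ)) * Real.log (1 / ε)) :
    ((n - k).choose m : ℝ) ≤ ε * n.choose m := by
  have hk : (0 : ℝ) < k := by exact_mod_cast hk1
  have hn : (0 : ℝ) < n := by exact_mod_cast hk1.trans hkn
  have hchoose : ((n - k).choose m : ℝ) * (n : ℝ) ^ m ≤ ((n : ℝ) - k) ^ m * n.choose m := by
    rw [← Nat.cast_sub hkn]
    exact_mod_cast choose_mul_pow_le (Nat.sub_le n k) m
  have hbase : (n : ℝ) - k ≤ n * Real.exp (-(k / n)) := by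
    have hexp := mul_le_mul_of_nonneg_left (Real.add_one_le_exp (-((k : ℝ) / n))) hn.le
    have hmul : (n : ℝ) * (-((k : ℝ) / n) + 1) = n - k := by field_simp; ring
    linarith
  have hlog : m * (-((k : ℝ) / n)) ≤ Real.log ε := by
    rw [one_div, Real.log_inv] at hm
    have hscaled := mul_le_mul_of_nonneg_left hm (div_pos hk hn).le
    have hcancel : (k : ℝ) / n * (n / k * -Real.log ε) = -Real.log ε := by field_simp
    linarith
  have hpow : ((n : ℝ) - k) ^ m ≤ (n : ℝ) ^ m * ε := by
    calc ((n : ℝ) - k) ^ m ≤ (n * Real.exp (-(k / n))) ^ m :=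
          pow_le_pow_left₀ (sub_nonneg.mpr (by exact_mod_cast hkn)) hbase m
      _ = (n : ℝ) ^ m * Real.exp (m * (-(k / n))) := by rw [mul_pow, ← Real.exp_nat_mul]
      _ ≤ (n : ℝ) ^ m * ε := by
          gcongr
          exact (Real.le_log_iff_exp_le hε0).mp (by simpa using hlog)
  refine le_of_mul_le_mul_right ?_ (pow_pos hn m)
  calc ((n - k).choose m : ℝ) * (n : ℝ) ^ m ≤ ((n : ℝ) - k) ^ m * n.choose m := hchoose
    _ ≤ ((n : ℝ) ^ m * ε) * n.choose m := by gcongr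
    _ = ε * n.choose m * (n : ℝ) ^ m := by ring

/-- The total share `1 / |S ∩ A|` that `e ∈ A` receives from the `m`-subsets `S` containing it. -/
noncomputable def hitShare {α : Type*} [DecidableEq α] (E A : Finset α) (m : ℕ) (e : α) : ℝ :=
  ∑ S ∈ E.powersetCard m, if e ∈ S then ((S ∩ A).card : ℝ)⁻¹ else 0

theorem Finset.map_swap_eq_self {α : Type*} [DecidableEq α] {s : Finset α} {e f : α}
    (he : e ∈ s) (hf : f ∈ s) : s.map (Equiv.swap e f).toEmbedding = s := by
  refine Finset.eq_of_subset_of_card_le (fun x hx => ?_) (by simp)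
  obtain ⟨y, hy, rfl⟩ := Finset.mem_map.mp hx
  simp only [Equiv.coe_toEmbedding, Equiv.swap_apply_def]
  split_ifs <;> assumption

theorem hitShare_eq {α : Type*} [DecidableEq α] {E A : Finset α} (hAE : A ⊆ E) (m : ℕ) {e f : α}
    (he : e ∈ A) (hf : f ∈ A) : hitShare E A m e = hitShare E A m f := by
  refine Finset.sum_equiv (Equiv.swap e f).finsetCongr (fun S => ?_) (fun S _ => ?_)
  · have hE := Finset.map_swap_eq_self (hAE he) (hAE hf)
    rw [Finset.mem_powersetCard, Finset.mem_powersetCard, Equiv.finsetCongr_apply,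
      Finset.card_map]
    nth_rewrite 2 [← hE]
    rw [Finset.map_subset_map]
  · have hmem : f ∈ S.map (Equiv.swap e f).toEmbedding ↔ e ∈ S := by
      simp [Finset.mem_map_equiv]
    have hcard : (S.map (Equiv.swap e f).toEmbedding ∩ A).card = (S ∩ A).card := by
      nth_rewrite 1 [← Finset.map_swap_eq_self he hf]
      rw [← Finset.map_inter, Finset.card_map]
    simp only [Equiv.finsetCongr_apply, hmem, hcard]

theorem sum_mul_hitShare {α : Type*} [DecidableEq α] (E A : Finset α) (w : α → ℝ) (m : ℕ) :
    ∑ e ∈ A, w e * hitShare E A m e =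
      ∑ S ∈ E.powersetCard m, ((S ∩ A).card : ℝ)⁻¹ * ∑ e ∈ S ∩ A, w e := by
  simp only [hitShare, Finset.mul_sum]
  rw [Finset.sum_comm]
  refine Finset.sum_congr rfl fun S _ => ?_
  rw [Finset.inter_comm S A, ← Finset.filter_mem_eq_inter, Finset.sum_filter]
  refine Finset.sum_congr rfl fun e _ => ?_
  split_ifs <;> ring

theorem sum_hitShare {α : Type*} [DecidableEq α] {E A : Finset α} (hAE : A ⊆ E) (m : ℕ) :
    ∑ e ∈ A, hitShare E A m e = (E.card.choose m : ℝ) - ((E.card - A.card).choose m : ℝ) := by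
  have hmiss : (E.powersetCard m).filter (fun S => S ∩ A = ∅) = (E \ A).powersetCard m := by
    ext S
    simp only [Finset.mem_filter, Finset.mem_powersetCard, Finset.subset_sdiff,
      Finset.disjoint_iff_inter_eq_empty]
    tauto
  have hsum := sum_mul_hitShare E A (fun _ => 1) m
  simp only [one_mul, Finset.sum_const, nsmul_eq_mul, mul_one] at hsum
  have hterm : ∀ S ∈ E.powersetCard m, ((S ∩ A).card : ℝ)⁻¹ * ((S ∩ A).card : ℝ) =
      1 - if S ∩ A = ∅ then 1 else 0 := by
    intro S _
    split_ifs with h <;> simp [h]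
  rw [hsum, Finset.sum_congr rfl hterm, Finset.sum_sub_distrib, Finset.sum_boole, hmiss]
  simp [Finset.card_powersetCard, Finset.card_sdiff_of_subset hAE]

/-- The maximum over `S` dominates the average over the part of `S` inside `A`. -/
theorem inv_card_mul_sum_inter_le_sup' {α : Type*} [DecidableEq α] {S : Finset α} (A : Finset α)
    {w : α → ℝ} (hw : ∀ e, 0 ≤ w e) (hS : S.Nonempty) :
    ((S ∩ A).card : ℝ)⁻¹ * ∑ e ∈ S ∩ A, w e ≤ S.sup' hS w := by
  rcases (S ∩ A).eq_empty_or_nonempty with h | h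
  · obtain ⟨x, hx⟩ := hS
    simpa [h] using (hw x).trans (Finset.le_sup' w hx)
  · rw [inv_mul_le_iff₀ (by exact_mod_cast h.card_pos), ← nsmul_eq_mul]
    exact Finset.sum_le_card_nsmul _ _ _ fun e he =>
      Finset.le_sup' w (Finset.mem_inter.mp he).1

open Finset in
/-- Combined per-round guarantee: with `|E| = n`, `A ⊆ E`, `|A| = k`, `1 ≤ k ≤ n`,
`0 < ε ≤ 1`, `1 ≤ m ≤ n` and `(m : ℝ) ≥ (n/k) · log(1/ε)`, the average over all
`m`-element subsets `S` of `E` of `max_{e ∈ S} w e` is at least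
`((1 − ε)/k) · Σ_{e ∈ A} w e`. -/
theorem avg_max_ge_one_sub_eps_avg {α : Type*} [DecidableEq α]
    (E A : Finset α) (w : α → ℝ) (n k m : ℕ) (ε : ℝ)
    (hw : ∀ e, 0 ≤ w e)
    (hE : E.card = n) (hAE : A ⊆ E) (hA : A.card = k)
    (hk1 : 1 ≤ k) (hkn : k ≤ n)
    (hε0 : 0 < ε) (hε1 : ε ≤ 1)
    (hm1 : 1 ≤ m) (hmn : m ≤ n)
    (hm : (m : ℝ) ≥ ((n : ℝ) / (k : ℝ)) * Real.log (1 / ε)) :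
    ((1 : ℝ) / (n.choose m : ℝ)) * (∑ S ∈ (E.powersetCard m).attach,
          S.1.sup' (Finset.card_pos.mp (by
            have h := (Finset.mem_powersetCard.mp S.2).2
            omega)) w)
      ≥ ((1 - ε) / (k : ℝ)) * (∑ e ∈ A, w e) := by
  have hk : (0 : ℝ) < k := by exact_mod_cast hk1
  have hC : (0 : ℝ) < n.choose m := by exact_mod_cast Nat.choose_pos hmn
  have hshare : ∀ e ∈ A, (1 - ε) * n.choose m / k ≤ hitShare E A m e := by
    intro e he
    have htotal := sum_hitShare hAE m
    rw [Finset.sum_congr rfl fun f hf => hitShare_eq hAE m hf he, Finset.sum_const, nsmul_eq_mul,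
      hE, hA] at htotal
    rw [div_le_iff₀ hk]
    linarith [choose_sub_le_mul_choose hk1 hkn hε0 hm]
  rw [ge_iff_le, one_div, ← div_eq_inv_mul, le_div_iff₀ hC]
  calc (1 - ε) / k * (∑ e ∈ A, w e) * n.choose m
      = ∑ e ∈ A, w e * ((1 - ε) * n.choose m / k) := by rw [← Finset.sum_mul]; ring
    _ ≤ ∑ e ∈ A, w e * hitShare E A m e :=
        Finset.sum_le_sum fun e he => mul_le_mul_of_nonneg_left (hshare e he) (hw e)
    _ = ∑ S ∈ (E.powersetCard m).attach, ((S.1 ∩ A).card : ℝ)⁻¹ * ∑ e ∈ S.1 ∩ A, w e := by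
        rw [sum_mul_hitShare]
        exact (Finset.sum_attach _ fun S => ((S ∩ A).card : ℝ)⁻¹ * ∑ e ∈ S ∩ A, w e).symm
    _ ≤ _ := Finset.sum_le_sum fun S _ => inv_card_mul_sum_inter_le_sup' A hw _
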